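/- arXiv:2312.09829 — 3 statements merged into one kernel-verified Lean document; each statement's English description precedes it below -/
import Mathlib

section
/- Let φ act ℝ-linearly on quadruples of polynomials by φ·(f₁,f₂,f₃,f₄) = (σ(f₃), σ(f₂), σ(f₁), σ(f₄)), where σ is the ℝ-algebra automorphism of ℝ[x,y] exchanging x and y. Then φ maps S⁰₁(G) to itself, is an involution on S⁰₁(G), its (+1)-eigenspace {f ∈ S⁰₁(G) : φ·f = f} has dimension 3, and its (−1)-eigenspace {f ∈ S⁰₁(G) : φ·f = −f} has dimension 2. -/
open MvPolynomial

/-- The degree-bounded spline space `S^r_d(G)` for the 4-cycle with edge labels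
`ℓ(v₁v₂) = l12`, `ℓ(v₂v₃) = l23`, `ℓ(v₃v₄) = l34`, `ℓ(v₄v₁) = l41`, as an
`ℝ`-subspace of quadruples of polynomials in `ℝ[x,y]`. -/
noncomputable def splineSubmodule (l12 l23 l34 l41 : MvPolynomial (Fin 2) ℝ)
    (r d : ℕ) : Submodule ℝ (Fin 4 → MvPolynomial (Fin 2) ℝ) where
  carrier := {f | l12 ^ (r + 1) ∣ f 0 - f 1 ∧ l23 ^ (r + 1) ∣ f 1 - f 2 ∧
    l34 ^ (r + 1) ∣ f 2 - f 3 ∧ l41 ^ (r + 1) ∣ f 3 - f 0 ∧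
    ∀ i, (f i).totalDegree ≤ d}
  add_mem' := by
    rintro a b ⟨ha1, ha2, ha3, ha4, ha5⟩ ⟨hb1, hb2, hb3, hb4, hb5⟩
    refine ⟨?_, ?_, ?_, ?_, ?_⟩
    · simpa [Pi.add_apply, add_sub_add_comm] using dvd_add ha1 hb1
    · simpa [Pi.add_apply, add_sub_add_comm] using dvd_add ha2 hb2
    · simpa [Pi.add_apply, add_sub_add_comm] using dvd_add ha3 hb3
    · simpa [Pi.add_apply, add_sub_add_comm] using dvd_add ha4 hb4
    · intro i
      exact le_trans (totalDegree_add _ _) (max_le (ha5 i) (hb5 i))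
  zero_mem' := by
    refine ⟨⟨0, by simp⟩, ⟨0, by simp⟩, ⟨0, by simp⟩, ⟨0, by simp⟩, ?_⟩
    intro i
    simp
  smul_mem' := by
    rintro c a ⟨ha1, ha2, ha3, ha4, ha5⟩
    refine ⟨?_, ?_, ?_, ?_, ?_⟩
    · simpa [Pi.smul_apply, smul_eq_C_mul, ← mul_sub] using (ha1.mul_left (C c))
    · simpa [Pi.smul_apply, smul_eq_C_mul, ← mul_sub] using (ha2.mul_left (C c))
    · simpa [Pi.smul_apply, smul_eq_C_mul, ← mul_sub] using (ha3.mul_left (C c))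
    · simpa [Pi.smul_apply, smul_eq_C_mul, ← mul_sub] using (ha4.mul_left (C c))
    · intro i
      calc ((c • a) i).totalDegree = (c • (a i)).totalDegree := rfl
        _ ≤ (a i).totalDegree := totalDegree_smul_le c (a i)
        _ ≤ d := ha5 i

/-- The `ℝ`-algebra automorphism `σ` of `ℝ[x,y]` exchanging the variables `x` and
`y` (as an algebra homomorphism). -/

noncomputable def varSwap : MvPolynomial (Fin 2) ℝ →ₐ[ℝ] MvPolynomial (Fin 2) ℝ :=
  MvPolynomial.rename (Equiv.swap (0 : Fin 2) 1)

noncomputable def Tphi :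
    (Fin 4 → MvPolynomial (Fin 2) ℝ) →ₗ[ℝ] (Fin 4 → MvPolynomial (Fin 2) ℝ) where
  toFun f := ![varSwap (f 2), varSwap (f 1), varSwap (f 0), varSwap (f 3)]
  map_add' a b := by
    funext i
    fin_cases i <;> simp [varSwap]
  map_smul' c a := by
    funext i
    fin_cases i <;> simp [varSwap]

/-- A bivariate polynomial of total degree at most one is determined by its affine coefficients. -/
lemma eq_affine_of_totalDegree_le_one {R : Type*} [CommSemiring R] {f : MvPolynomial (Fin 2) R}
    (hf : f.totalDegree ≤ 1) :
    f = C (coeff 0 f) + C (coeff (Finsupp.single 0 1) f) * X 0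
      + C (coeff (Finsupp.single 1 1) f) * X 1 := by
  ext m
  obtain ⟨a, b, rfl⟩ : ∃ a b, m = Finsupp.single 0 a + Finsupp.single 1 b :=
    ⟨m 0, m 1, by ext i; fin_cases i <;> simp⟩
  by_cases hm : 1 < a + b
  · have hz : coeff (Finsupp.single 0 a + Finsupp.single 1 b) f = 0 := by
      by_contra hne
      have hle := (le_totalDegree (mem_support_iff.2 hne)).trans hf
      rw [Finsupp.sum_add_index' (by simp) (by simp)] at hle
      simp at hle
      omega
    rw [hz]
    simp only [coeff_add, coeff_C_mul, coeff_C, coeff_X, Finsupp.ext_iff, Fin.forall_fin_two]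
    simp
    split_ifs <;> first | omega | simp
  · obtain ⟨rfl, rfl⟩ | ⟨rfl, rfl⟩ | ⟨rfl, rfl⟩ :
        (a = 0 ∧ b = 0) ∨ (a = 1 ∧ b = 0) ∨ (a = 0 ∧ b = 1) := by omega
    all_goals
      simp [coeff_C, coeff_X, Finsupp.ext_iff, Fin.forall_fin_two]

/-- The polynomial `a + b x + c y`. -/
noncomputable def affinePoly (a b c : ℝ) : MvPolynomial (Fin 2) ℝ := C a + C b * X 0 + C c * X 1

lemma coeff_zero_affinePoly (a b c : ℝ) : coeff 0 (affinePoly a b c) = a := by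
  simp [affinePoly]

lemma coeff_single_zero_affinePoly (a b c : ℝ) :
    coeff (Finsupp.single 0 1) (affinePoly a b c) = b := by
  simp [affinePoly, coeff_C, coeff_X, Finsupp.ext_iff, Fin.forall_fin_two]

lemma coeff_single_one_affinePoly (a b c : ℝ) :
    coeff (Finsupp.single 1 1) (affinePoly a b c) = c := by
  simp [affinePoly, coeff_C, coeff_X, Finsupp.ext_iff, Fin.forall_fin_two]

lemma affinePoly_inj {a b c a' b' c' : ℝ} :
    affinePoly a b c = affinePoly a' b' c' ↔ a = a' ∧ b = b' ∧ c = c' := by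
  refine ⟨fun h => ⟨?_, ?_, ?_⟩, by rintro ⟨rfl, rfl, rfl⟩; rfl⟩
  · simpa [coeff_zero_affinePoly] using congrArg (coeff 0) h
  · simpa [coeff_single_zero_affinePoly] using congrArg (coeff (Finsupp.single 0 1)) h
  · simpa [coeff_single_one_affinePoly] using congrArg (coeff (Finsupp.single 1 1)) h

lemma totalDegree_affinePoly_le (a b c : ℝ) : (affinePoly a b c).totalDegree ≤ 1 := by
  have h (r : ℝ) (i : Fin 2) : (C r * X i : MvPolynomial (Fin 2) ℝ).totalDegree ≤ 1 :=
    (totalDegree_mul _ _).trans (by simp)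
  exact (totalDegree_add _ _).trans
    (max_le ((totalDegree_add _ _).trans (max_le (by simp) (h _ _))) (h _ _))

lemma affinePoly_add (a b c a' b' c' : ℝ) :
    affinePoly (a + a') (b + b') (c + c') = affinePoly a b c + affinePoly a' b' c' := by
  simp only [affinePoly, C_add]
  ring

lemma affinePoly_smul (r a b c : ℝ) :
    affinePoly (r * a) (r * b) (r * c) = r • affinePoly a b c := by
  simp only [affinePoly, C_mul, smul_eq_C_mul]
  ring

lemma X_zero_dvd_affinePoly_sub {a b c a' b' c' : ℝ} :
    X 0 ∣ affinePoly a b c - affinePoly a' b' c' ↔ a = a' ∧ c = c' := by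
  constructor
  · rintro ⟨q, hq⟩
    constructor
    · simpa [coeff_zero_affinePoly, sub_eq_zero, coeff_X_mul'] using congrArg (coeff 0) hq
    · simpa [coeff_single_one_affinePoly, sub_eq_zero, coeff_X_mul'] using
        congrArg (coeff (Finsupp.single 1 1)) hq
  · rintro ⟨rfl, rfl⟩
    exact ⟨C b - C b', by simp only [affinePoly]; ring⟩

lemma X_one_dvd_affinePoly_sub {a b c a' b' c' : ℝ} :
    X 1 ∣ affinePoly a b c - affinePoly a' b' c' ↔ a = a' ∧ b = b' := by
  constructor
  · rintro ⟨q, hq⟩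
    constructor
    · simpa [coeff_zero_affinePoly, sub_eq_zero, coeff_X_mul'] using congrArg (coeff 0) hq
    · simpa [coeff_single_zero_affinePoly, sub_eq_zero, coeff_X_mul'] using
        congrArg (coeff (Finsupp.single 0 1)) hq
  · rintro ⟨rfl, rfl⟩
    exact ⟨C c - C c', by simp only [affinePoly]; ring⟩

lemma varSwap_affinePoly (a b c : ℝ) : varSwap (affinePoly a b c) = affinePoly a c b := by
  simp only [varSwap, affinePoly, map_add, map_mul, rename_C, rename_X, Equiv.swap_apply_left,
    Equiv.swap_apply_right]
  ring

/-- The parametrization of the degree-one splines on the 4-cycle with edge labels `y, x, y, x`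
by the common constant term and the free linear coefficients. -/
noncomputable def linearSpline :
    (Fin 5 → ℝ) →ₗ[ℝ] (Fin 4 → MvPolynomial (Fin 2) ℝ) where
  toFun v := ![affinePoly (v 0) (v 1) (v 4), affinePoly (v 0) (v 1) (v 3),
    affinePoly (v 0) (v 2) (v 3), affinePoly (v 0) (v 2) (v 4)]
  map_add' v w := by
    funext i
    fin_cases i <;> simp [affinePoly_add]
  map_smul' r v := by
    funext i
    fin_cases i <;> simp [affinePoly_smul]

lemma linearSpline_injective : Function.Injective linearSpline := by
  intro v w h
  have h0 := congrFun h 0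
  have h2 := congrFun h 2
  simp only [linearSpline, LinearMap.coe_mk, AddHom.coe_mk, Matrix.cons_val, affinePoly_inj]
    at h0 h2
  funext i
  fin_cases i
  exacts [h0.1, h0.2.1, h2.2.1, h2.2.2, h0.2.2]

lemma range_linearSpline :
    LinearMap.range linearSpline = splineSubmodule (X 1) (X 0) (X 1) (X 0) 0 1 := by
  ext f
  constructor
  · rintro ⟨v, rfl⟩
    simp only [splineSubmodule, Submodule.mem_mk, AddSubmonoid.mem_mk, AddSubsemigroup.mem_mk,
      Set.mem_ofPred_eq, linearSpline, LinearMap.coe_mk, AddHom.coe_mk, Matrix.cons_val, zero_add,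
      pow_one, X_zero_dvd_affinePoly_sub, X_one_dvd_affinePoly_sub, and_self, true_and]
    intro i
    fin_cases i <;> exact totalDegree_affinePoly_le _ _ _
  · rintro ⟨h01, h12, h23, h30, hdeg⟩
    have haff (i : Fin 4) : ∃ a b c, f i = affinePoly a b c :=
      ⟨_, _, _, eq_affine_of_totalDegree_le_one (hdeg i)⟩
    choose a b c hf using haff
    simp only [zero_add, pow_one, hf, X_zero_dvd_affinePoly_sub, X_one_dvd_affinePoly_sub]
      at h01 h12 h23 h30
    refine ⟨![a 0, b 0, b 2, c 1, c 0], ?_⟩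
    funext i
    rw [hf]
    fin_cases i <;> simp [linearSpline, affinePoly_inj] <;> grind

lemma Tphi_linearSpline (v : Fin 5 → ℝ) :
    Tphi (linearSpline v) = linearSpline ![v 0, v 3, v 4, v 1, v 2] := by
  funext i
  fin_cases i <;> simp [Tphi, linearSpline, varSwap_affinePoly]

/-- The coefficient vectors of the symmetric degree-one splines. -/
def symmCoeffs : (Fin 3 → ℝ) →ₗ[ℝ] (Fin 5 → ℝ) where
  toFun u := ![u 0, u 1, u 2, u 1, u 2]
  map_add' u w := by
    funext i
    fin_cases i <;> simp
  map_smul' r u := by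
    funext i
    fin_cases i <;> simp

/-- The coefficient vectors of the antisymmetric degree-one splines. -/
def antisymmCoeffs : (Fin 2 → ℝ) →ₗ[ℝ] (Fin 5 → ℝ) where
  toFun u := ![0, u 0, u 1, -u 0, -u 1]
  map_add' u w := by
    funext i
    fin_cases i <;> simp [add_comm]
  map_smul' r u := by
    funext i
    fin_cases i <;> simp

lemma symmCoeffs_injective : Function.Injective symmCoeffs := by
  intro u w h
  funext i
  fin_cases i
  exacts [congrFun h 0, congrFun h 1, congrFun h 2]

lemma antisymmCoeffs_injective : Function.Injective antisymmCoeffs := by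
  intro u w h
  funext i
  fin_cases i
  exacts [congrFun h 1, congrFun h 2]

lemma range_linearSpline_inf_ker_sub :
    LinearMap.range linearSpline ⊓ LinearMap.ker (Tphi - LinearMap.id) =
      LinearMap.range (linearSpline ∘ₗ symmCoeffs) := by
  ext f
  constructor
  · rintro ⟨⟨v, rfl⟩, hv⟩
    have h : linearSpline ![v 0, v 3, v 4, v 1, v 2] = linearSpline v := by
      simpa [sub_eq_zero, Tphi_linearSpline] using hv
    have h' := linearSpline_injective h
    have h1 : v 3 = v 1 := congrFun h' 1
    have h2 : v 4 = v 2 := congrFun h' 2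
    refine ⟨![v 0, v 1, v 2], congrArg linearSpline ?_⟩
    funext i
    fin_cases i <;> simp [symmCoeffs, h1, h2]
  · rintro ⟨u, rfl⟩
    refine ⟨⟨symmCoeffs u, rfl⟩, ?_⟩
    simp [Tphi_linearSpline, symmCoeffs]

lemma range_linearSpline_inf_ker_add :
    LinearMap.range linearSpline ⊓ LinearMap.ker (Tphi + LinearMap.id) =
      LinearMap.range (linearSpline ∘ₗ antisymmCoeffs) := by
  ext f
  constructor
  · rintro ⟨⟨v, rfl⟩, hv⟩
    have h : linearSpline ![v 0, v 3, v 4, v 1, v 2] = linearSpline (-v) := by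
      simpa [add_eq_zero_iff_eq_neg, Tphi_linearSpline] using hv
    have h' := linearSpline_injective h
    have h0 : v 0 = -v 0 := congrFun h' 0
    have h1 : v 3 = -v 1 := congrFun h' 1
    have h2 : v 4 = -v 2 := congrFun h' 2
    have h0' : v 0 = 0 := by linarith
    refine ⟨![v 1, v 2], congrArg linearSpline ?_⟩
    funext i
    fin_cases i <;> simp [antisymmCoeffs, h0', h1, h2]
  · rintro ⟨u, rfl⟩
    refine ⟨⟨antisymmCoeffs u, rfl⟩, ?_⟩
    rw [SetLike.mem_coe, LinearMap.mem_ker, LinearMap.add_apply, LinearMap.id_apply, LinearMap.comp_apply,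
      Tphi_linearSpline, ← map_add]
    convert map_zero linearSpline
    funext i
    fin_cases i <;> simp [antisymmCoeffs]

/-- The graph automorphism `φ` of the 4-cycle with edge labels `y, x, y, x` that swaps
`v₁ ↔ v₃` and fixes `v₂, v₄`, combined with the variable swap `x ↔ y`, acts on
quadruples by `φ·(f₁,f₂,f₃,f₄) = (σ f₃, σ f₂, σ f₁, σ f₄)`. It maps `S⁰₁(G)` to
itself, is an involution on `S⁰₁(G)`, its `(+1)`-eigenspace in `S⁰₁(G)` has dimension
`3`, and its `(−1)`-eigenspace has dimension `2`. -/
theorem involution_on_S01_eigenspace_dims :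
    let S := splineSubmodule (X 1) (X 0) (X 1) (X 0) 0 1
    (∀ f ∈ S, Tphi f ∈ S) ∧
    (∀ f ∈ S, Tphi (Tphi f) = f) ∧
    Module.finrank ℝ ↥(S ⊓ LinearMap.ker (Tphi - LinearMap.id)) = 3 ∧
    Module.finrank ℝ ↥(S ⊓ LinearMap.ker (Tphi + LinearMap.id)) = 2 := by
  intro S
  have hS : S = LinearMap.range linearSpline := range_linearSpline.symm
  rw [hS]
  refine ⟨?_, ?_, ?_, ?_⟩
  · rintro _ ⟨v, rfl⟩
    exact ⟨_, (Tphi_linearSpline v).symm⟩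
  · rintro _ ⟨v, rfl⟩
    rw [Tphi_linearSpline, Tphi_linearSpline]
    congr 1
    funext i
    fin_cases i <;> rfl
  · rw [range_linearSpline_inf_ker_sub, LinearMap.finrank_range_of_inj, Module.finrank_fin_fun]
    exact linearSpline_injective.comp symmCoeffs_injective
  · rw [range_linearSpline_inf_ker_add, LinearMap.finrank_range_of_inj, Module.finrank_fin_fun]
    exact linearSpline_injective.comp antisymmCoeffs_injective
end

section
/- For every integer d ≥ 1, the real dimension of S¹_d(G) equals 2d² − 2d + 3. -/
open MvPolynomial

namespace MvPolynomial

/-- The polynomials all of whose monomials have degree less than `n`. -/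
noncomputable abbrev degreeLT (σ R : Type*) [CommSemiring R] (n : ℕ) :
    Submodule R (MvPolynomial σ R) :=
  restrictSupport R {m | m.degree < n}

section

variable {σ R : Type*} [CommSemiring R]

theorem mem_degreeLT {n : ℕ} {f : MvPolynomial σ R} :
    f ∈ degreeLT σ R n ↔ f = 0 ∨ f.totalDegree < n := by
  rw [mem_restrictSupport_iff]
  rcases Nat.eq_zero_or_pos n with rfl | hn
  · simp
  · have h : (↑f.support ⊆ {m : σ →₀ ℕ | m.degree < n}) ↔ f.totalDegree < n := by
      rw [totalDegree, Finset.sup_lt_iff (by simpa using hn)]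
      rfl
    rw [h, iff_or_self]
    rintro rfl
    simpa using hn

theorem mem_degreeLT_succ {n : ℕ} {f : MvPolynomial σ R} :
    f ∈ degreeLT σ R (n + 1) ↔ f.totalDegree ≤ n := by
  rw [mem_degreeLT, Nat.lt_succ_iff, or_iff_right_iff_imp]
  rintro rfl
  simp

theorem IsHomogeneous.mul_mem_degreeLT_iff [IsDomain R] {n k : ℕ} {q a : MvPolynomial σ R}
    (hq : q.IsHomogeneous k) (hq0 : q ≠ 0) :
    q * a ∈ degreeLT σ R n ↔ a ∈ degreeLT σ R (n - k) := by
  rcases eq_or_ne a 0 with rfl | ha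
  · simp
  · rw [mem_degreeLT, mem_degreeLT, totalDegree_mul_of_isDomain hq0 ha, hq.totalDegree hq0]
    simp only [mul_eq_zero, hq0, ha, or_self, false_or]
    omega

theorem IsHomogeneous.coeff_mul_eq_zero {k : ℕ} {q : MvPolynomial σ R}
    (hq : q.IsHomogeneous k) (a : MvPolynomial σ R) {m : σ →₀ ℕ} (hm : m.degree < k) :
    coeff m (q * a) = 0 := by
  classical
  rw [coeff_mul]
  refine Finset.sum_eq_zero fun u hu => ?_
  rw [hq.coeff_eq_zero, zero_mul]
  have : u.1.degree + u.2.degree = m.degree := by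
    rw [← map_add, Finset.HasAntidiagonal.mem_antidiagonal.1 hu]
  omega

end

instance (σ R : Type*) [Finite σ] [CommRing R] (n : ℕ) : Module.Finite R (degreeLT σ R n) :=
  have := (Finsupp.finite_of_degree_lt (σ := σ) n).to_subtype
  Module.Finite.of_basis (basisRestrictSupport R _)

theorem finrank_degreeLT_two_variables (R : Type*) [CommRing R] [Nontrivial R] (n : ℕ) :
    Module.finrank R (degreeLT (Fin 2) R n) = (n + 1).choose 2 := by
  rw [Module.finrank_eq_nat_card_basis (basisRestrictSupport R _), Nat.card_coe_set_eq]
  have h : {m : Fin 2 →₀ ℕ | m.degree < n} =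
      (fun p : (_ : ℕ) × ℕ × ℕ => Finsupp.equivFunOnFinite.symm ![p.2.1, p.2.2]) ''
        ((Finset.range n).sigma fun i => Finset.HasAntidiagonal.antidiagonal i) := by
    ext m
    simp only [Set.mem_ofPred_eq, Finsupp.degree_eq_sum, Fin.sum_univ_two, Set.mem_image,
      Finset.mem_coe, Finset.mem_sigma, Finset.mem_range, Finset.HasAntidiagonal.mem_antidiagonal]
    constructor
    · intro hm
      refine ⟨⟨m 0 + m 1, m 0, m 1⟩, ⟨hm, rfl⟩, ?_⟩
      ext i
      fin_cases i <;> rfl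
    · rintro ⟨⟨i, a, b⟩, ⟨hi, hab⟩, rfl⟩
      simpa [hab] using hi
  rw [h, Set.InjOn.ncard_image, Set.ncard_coe_finset, Finset.card_sigma]
  · simp only [Finset.Nat.card_antidiagonal]
    rw [← Finset.sum_range_succ' (fun i => i) n |>.trans (add_zero _), Finset.sum_range_id,
      Nat.choose_two_right]
  · rintro ⟨i, a, b⟩ hp ⟨j, a', b'⟩ hp' h
    have h0 := DFunLike.congr_fun h 0
    have h1 := DFunLike.congr_fun h 1
    simp at h0 h1 hp hp'
    obtain ⟨-, rfl⟩ := hp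
    obtain ⟨-, rfl⟩ := hp'
    subst h0 h1
    rfl

end MvPolynomial

section

variable (l12 l23 l34 l41 : MvPolynomial (Fin 2) ℝ) (r d : ℕ)

/-- The linear map whose kernel is the space of degree-bounded syzygies of the powers of
the edge labels. -/
noncomputable def edgeSum :
    degreeLT (Fin 2) ℝ (d - r) × degreeLT (Fin 2) ℝ (d - r) × degreeLT (Fin 2) ℝ (d - r) ×
      degreeLT (Fin 2) ℝ (d - r) →ₗ[ℝ] MvPolynomial (Fin 2) ℝ :=
  let m (l : MvPolynomial (Fin 2) ℝ) :=
    LinearMap.mulLeft ℝ (l ^ (r + 1)) ∘ₗ (degreeLT (Fin 2) ℝ (d - r)).subtype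
  (m l12).coprod ((m l23).coprod ((m l34).coprod (m l41)))

theorem edgeSum_apply (a b c e : degreeLT (Fin 2) ℝ (d - r)) :
    edgeSum l12 l23 l34 l41 r d (a, b, c, e) =
      l12 ^ (r + 1) * a + l23 ^ (r + 1) * b + l34 ^ (r + 1) * c + l41 ^ (r + 1) * e := by
  simp [edgeSum, add_assoc]

/-- The quadruple with prescribed first entry and prescribed successive differences
along the first, second and fourth edges. -/
noncomputable def splineOfSyzygy :
    degreeLT (Fin 2) ℝ (d + 1) × LinearMap.ker (edgeSum l12 l23 l34 l41 r d) →ₗ[ℝ]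
      (Fin 4 → MvPolynomial (Fin 2) ℝ) where
  toFun x := ![x.1, x.1 - l12 ^ (r + 1) * x.2.1.1,
    x.1 - l12 ^ (r + 1) * x.2.1.1 - l23 ^ (r + 1) * x.2.1.2.1,
    x.1 + l41 ^ (r + 1) * x.2.1.2.2.2]
  map_add' x y := by
    ext1 i
    fin_cases i <;> simp <;> ring
  map_smul' t x := by
    ext1 i
    fin_cases i <;> simp [smul_eq_C_mul] <;> ring

variable {l12 l23 l34 l41 r d}

theorem splineOfSyzygy_injective (h12 : l12 ≠ 0) (h23 : l23 ≠ 0) (h34 : l34 ≠ 0)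
    (h41 : l41 ≠ 0) : Function.Injective (splineOfSyzygy l12 l23 l34 l41 r d) := by
  refine (injective_iff_map_eq_zero _).2 ?_
  rintro ⟨q, ⟨⟨a, b, c, e⟩, hs⟩⟩ h
  rw [LinearMap.mem_ker, edgeSum_apply] at hs
  have h0 := congrFun h 0
  have h1 := congrFun h 1
  have h2 := congrFun h 2
  have h3 := congrFun h 3
  simp [splineOfSyzygy] at h0 h1 h2 h3
  subst h0
  simp [h12] at h1
  subst h1
  simp [h23] at h2
  subst h2
  simp [h41] at h3
  subst h3
  simp [h34] at hs
  subst hs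
  rfl

theorem range_splineOfSyzygy (h12 : l12.IsHomogeneous 1) (h23 : l23.IsHomogeneous 1)
    (h34 : l34.IsHomogeneous 1) (h41 : l41.IsHomogeneous 1) (z12 : l12 ≠ 0) (z23 : l23 ≠ 0)
    (z34 : l34 ≠ 0) (z41 : l41 ≠ 0) :
    LinearMap.range (splineOfSyzygy l12 l23 l34 l41 r d) =
      splineSubmodule l12 l23 l34 l41 r d := by
  have key {l a : MvPolynomial (Fin 2) ℝ} (h : l.IsHomogeneous 1) (z : l ≠ 0) :
      l ^ (r + 1) * a ∈ degreeLT (Fin 2) ℝ (d + 1) ↔ a ∈ degreeLT (Fin 2) ℝ (d - r) := by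
    rw [(h.pow (r + 1)).mul_mem_degreeLT_iff (pow_ne_zero _ z), one_mul, Nat.add_sub_add_right]
  ext f
  constructor
  · rintro ⟨⟨q, ⟨⟨a, b, c, e⟩, hs⟩⟩, rfl⟩
    rw [LinearMap.mem_ker, edgeSum_apply] at hs
    have ha := (key h12 z12).2 a.2
    have hb := (key h23 z23).2 b.2
    have he := (key h41 z41).2 e.2
    refine ⟨⟨a, ?_⟩, ⟨b, ?_⟩, ⟨c, ?_⟩, ⟨e, ?_⟩, fun i => mem_degreeLT_succ.1 ?_⟩
    · simp [splineOfSyzygy]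
    · simp [splineOfSyzygy]
    · simp only [splineOfSyzygy, LinearMap.coe_mk, AddHom.coe_mk, Matrix.cons_val]
      linear_combination -hs
    · simp [splineOfSyzygy]
    · fin_cases i
      · exact q.2
      · exact sub_mem q.2 ha
      · exact sub_mem (sub_mem q.2 ha) hb
      · exact add_mem q.2 he
  · rintro ⟨⟨a, ha⟩, ⟨b, hb⟩, ⟨c, hc⟩, ⟨e, he⟩, hd⟩
    have hd' (i) : f i ∈ degreeLT (Fin 2) ℝ (d + 1) := mem_degreeLT_succ.2 (hd i)
    refine ⟨⟨⟨f 0, hd' 0⟩, ⟨⟨⟨a, (key h12 z12).1 (ha ▸ sub_mem (hd' _) (hd' _))⟩,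
      ⟨b, (key h23 z23).1 (hb ▸ sub_mem (hd' _) (hd' _))⟩,
      ⟨c, (key h34 z34).1 (hc ▸ sub_mem (hd' _) (hd' _))⟩,
      ⟨e, (key h41 z41).1 (he ▸ sub_mem (hd' _) (hd' _))⟩⟩, ?_⟩⟩, ?_⟩
    · rw [LinearMap.mem_ker, edgeSum_apply]
      linear_combination -ha - hb - hc - he
    · ext1 i
      fin_cases i <;> simp [splineOfSyzygy, ← ha, ← hb, ← he]

theorem finrank_splineSubmodule_add (h12 : l12.IsHomogeneous 1) (h23 : l23.IsHomogeneous 1)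
    (h34 : l34.IsHomogeneous 1) (h41 : l41.IsHomogeneous 1) (z12 : l12 ≠ 0) (z23 : l23 ≠ 0)
    (z34 : l34 ≠ 0) (z41 : l41 ≠ 0) :
    Module.finrank ℝ (splineSubmodule l12 l23 l34 l41 r d) +
        Module.finrank ℝ (LinearMap.range (edgeSum l12 l23 l34 l41 r d)) =
      (d + 2).choose 2 + 4 * (d - r + 1).choose 2 := by
  have hrn := LinearMap.finrank_range_add_finrank_ker (edgeSum l12 l23 l34 l41 r d)
  simp only [Module.finrank_prod, finrank_degreeLT_two_variables] at hrn
  have : Module.Free ℝ (LinearMap.ker (edgeSum l12 l23 l34 l41 r d)) :=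
    Module.Free.of_divisionRing ℝ (LinearMap.ker (edgeSum l12 l23 l34 l41 r d))
  rw [← range_splineOfSyzygy h12 h23 h34 h41 z12 z23 z34 z41,
    LinearMap.finrank_range_of_inj (splineOfSyzygy_injective z12 z23 z34 z41),
    Module.finrank_prod, finrank_degreeLT_two_variables]
  lia

end

theorem isHomogeneous_X_one_sub_three_mul_X_zero :
    (X 1 - 3 * X 0 : MvPolynomial (Fin 2) ℝ).IsHomogeneous 1 := by
  have h : (3 : MvPolynomial (Fin 2) ℝ) = C 3 := (map_ofNat C 3).symm
  rw [h]
  exact (isHomogeneous_X ℝ 1).sub (isHomogeneous_C_mul_X 3 0)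

theorem X_one_sub_three_mul_X_zero_ne_zero :
    (X 1 - 3 * X 0 : MvPolynomial (Fin 2) ℝ) ≠ 0 := by
  intro h
  simpa using congrArg (eval ![0, 1]) h

theorem disjoint_range_edgeSum_degreeLT {l12 l23 l34 l41 : MvPolynomial (Fin 2) ℝ}
    (h12 : l12.IsHomogeneous 1) (h23 : l23.IsHomogeneous 1)
    (h34 : l34.IsHomogeneous 1) (h41 : l41.IsHomogeneous 1) (r d : ℕ) :
    Disjoint (LinearMap.range (edgeSum l12 l23 l34 l41 r d)) (degreeLT (Fin 2) ℝ (r + 1)) := by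
  rw [Submodule.disjoint_def]
  rintro _ ⟨⟨a, b, c, e⟩, rfl⟩ h
  ext m
  by_contra hm
  have hdeg : m.degree < r + 1 := ((mem_restrictSupport_iff ℝ).1 h) (by simpa using hm)
  have key {l : MvPolynomial (Fin 2) ℝ} (hl : l.IsHomogeneous 1) (a : MvPolynomial (Fin 2) ℝ) :
      coeff m (l ^ (r + 1) * a) = 0 :=
    (hl.pow (r + 1)).coeff_mul_eq_zero a (by omega)
  exact hm (by simp [edgeSum_apply, key h12, key h23, key h34, key h41])

theorem range_edgeSum_sup_degreeLT (d : ℕ) (hd : 1 ≤ d) :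
    LinearMap.range (edgeSum (X 1) (X 1 - 3 * X 0) (X 1) (X 0) 1 d) ⊔ degreeLT (Fin 2) ℝ 2 =
      degreeLT (Fin 2) ℝ (d + 1) := by
  apply le_antisymm
  · refine sup_le ?_ (restrictSupport_mono _ fun m (hm : m.degree < 2) =>
      show m.degree < d + 1 by omega)
    rintro _ ⟨⟨a, b, c, e⟩, rfl⟩
    rw [edgeSum_apply]
    have key {l : MvPolynomial (Fin 2) ℝ} (h : l.IsHomogeneous 1) (z : l ≠ 0)
        (a : degreeLT (Fin 2) ℝ (d - 1)) :
        l ^ (1 + 1) * (a : MvPolynomial (Fin 2) ℝ) ∈ degreeLT (Fin 2) ℝ (d + 1) :=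
      ((h.pow 2).mul_mem_degreeLT_iff (pow_ne_zero _ z)).2 a.2
    exact add_mem (add_mem (add_mem (key (isHomogeneous_X ℝ 1) (X_ne_zero 1) a)
      (key isHomogeneous_X_one_sub_three_mul_X_zero X_one_sub_three_mul_X_zero_ne_zero b))
      (key (isHomogeneous_X ℝ 1) (X_ne_zero 1) c)) (key (isHomogeneous_X ℝ 0) (X_ne_zero 0) e)
  · refine (restrictSupport_eq_span ℝ _).trans_le (Submodule.span_le.2 ?_)
    rintro _ ⟨m, hm, rfl⟩
    rw [Set.mem_ofPred_eq] at hm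
    by_cases hm2 : m.degree < 2
    · exact Submodule.mem_sup_right ((monomial_mem_restrictSupport ℝ).2 (.inl hm2))
    refine Submodule.mem_sup_left ?_
    have factor (u : Fin 2 →₀ ℕ) (hu : u ≤ m) (hu2 : u.degree = 2) :
        ∃ v : degreeLT (Fin 2) ℝ (d - 1),
          monomial m (1 : ℝ) = monomial u 1 * (v : MvPolynomial (Fin 2) ℝ) := by
      have h : u + (m - u) = m := add_tsub_cancel_of_le hu
      refine ⟨⟨monomial (m - u) 1, ?_⟩, by simp [monomial_mul, h]⟩
      have := congrArg Finsupp.degree h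
      rw [map_add] at this
      rw [monomial_mem_restrictSupport, Set.mem_ofPred_eq]
      omega
    have hsum : m.degree = m 0 + m 1 := by rw [Finsupp.degree_eq_sum, Fin.sum_univ_two]
    by_cases h0 : 2 ≤ m 0
    · obtain ⟨v, hv⟩ := factor (Finsupp.single 0 2) (by simpa using h0) (by simp)
      exact ⟨(0, 0, 0, v), by simp [edgeSum_apply, hv, X_pow_eq_monomial]⟩
    by_cases h1 : 2 ≤ m 1
    · obtain ⟨v, hv⟩ := factor (Finsupp.single 1 2) (by simpa using h1) (by simp)
      exact ⟨(v, 0, 0, 0), by simp [edgeSum_apply, hv, X_pow_eq_monomial]⟩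
    obtain ⟨v, hv⟩ := factor (Finsupp.single 0 1 + Finsupp.single 1 1)
      (fun i => by fin_cases i <;> simp <;> omega) (by simp)
    -- `xy = (y² + 9x² - (y - 3x)²) / 6`
    refine ⟨((1 / 6 : ℝ) • v, (-1 / 6 : ℝ) • v, 0, (9 / 6 : ℝ) • v), ?_⟩
    have hxy : (monomial (Finsupp.single 0 1 + Finsupp.single 1 1) 1 : MvPolynomial (Fin 2) ℝ) =
        X 0 * X 1 := by
      simp [X, monomial_mul]
    have hC : (C (1 / 6 : ℝ) : MvPolynomial (Fin 2) ℝ) * 6 = 1 := by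
      rw [← map_ofNat C 6, ← C_mul]
      norm_num
    have hC1 : (C (-1 / 6 : ℝ) : MvPolynomial (Fin 2) ℝ) = -C (1 / 6) := by
      rw [← C_neg]
      norm_num
    have hC9 : (C (9 / 6 : ℝ) : MvPolynomial (Fin 2) ℝ) = 9 * C (1 / 6) := by
      rw [← map_ofNat C 9, ← C_mul]
      norm_num
    beta_reduce
    rw [hv, hxy, edgeSum_apply]
    simp only [Submodule.coe_smul, smul_eq_C_mul, hC1, hC9, ZeroMemClass.coe_zero]
    linear_combination (X 0 * X 1 * (v : MvPolynomial (Fin 2) ℝ)) * hC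

/-- For the 4-cycle with edge labels `y, y − 3x, y, x` and every `d ≥ 1`, the real
dimension of `S¹_d(G)` equals `2d² − 2d + 3`. -/
theorem dim_S1d_three_slopes (d : ℕ) (hd : 1 ≤ d) :
    Module.finrank ℝ
      (splineSubmodule (X 1) (X 1 - 3 * X 0) (X 1) (X 0) 1 d) =
      2 * d ^ 2 - 2 * d + 3 := by
  have hX (i : Fin 2) := isHomogeneous_X ℝ i
  have hl := isHomogeneous_X_one_sub_three_mul_X_zero
  have hS := finrank_splineSubmodule_add (r := 1) (d := d) (hX 1) hl (hX 1) (hX 0)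
    (X_ne_zero 1) X_one_sub_three_mul_X_zero_ne_zero (X_ne_zero 1) (X_ne_zero 0)
  have hR := Submodule.finrank_sup_add_finrank_inf_eq
    (LinearMap.range (edgeSum (X 1) (X 1 - 3 * X 0) (X 1) (X 0) 1 d)) (degreeLT (Fin 2) ℝ 2)
  rw [range_edgeSum_sup_degreeLT d hd,
    (disjoint_range_edgeSum_degreeLT (hX 1) hl (hX 1) (hX 0) 1 d).eq_bot, finrank_bot,
    finrank_degreeLT_two_variables, finrank_degreeLT_two_variables] at hR
  obtain ⟨k, rfl⟩ : ∃ k, d = k + 1 := ⟨d - 1, by omega⟩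
  have hk : (k + 1).choose 2 * 2 = (k + 1) * k := by
    simpa using Nat.choose_two_right (k + 1) ▸ Nat.div_mul_cancel (Nat.even_mul_pred_self _).two_dvd
  have hk2 : (k + 1 + 1 + 1).choose 2 = (k + 1 + 2).choose 2 := rfl
  have h3 : (2 + 1).choose 2 = 3 := rfl
  have hsq : 2 * (k + 1) ^ 2 - 2 * (k + 1) = 2 * ((k + 1) * k) := by
    rw [Nat.sub_eq_iff_eq_add (by nlinarith)]
    ring
  rw [hsq, ← hk]
  simp only [Nat.add_sub_cancel] at hS
  rw [h3] at hR
  omega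
end

section
/- For every integer d ≥ 0, the real dimension of S⁰_d(G) equals 2d² + 2d + 1. -/
open MvPolynomial

/-- Real bivariate polynomials of total degree less than `n`. -/
noncomputable def polysDegreeLT (n : ℕ) : Submodule ℝ (MvPolynomial (Fin 2) ℝ) :=
  restrictSupport ℝ {s | s.degree < n}

theorem mem_polysDegreeLT {n : ℕ} {p : MvPolynomial (Fin 2) ℝ} :
    p ∈ polysDegreeLT n ↔ p = 0 ∨ p.totalDegree < n := by
  rw [polysDegreeLT, mem_restrictSupport_iff]
  constructor
  · intro h
    rcases eq_or_ne p 0 with rfl | hp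
    · exact Or.inl rfl
    · obtain ⟨s, hs⟩ := support_nonempty.mpr hp
      have hn : 0 < n := (Nat.zero_le _).trans_lt (h hs)
      refine Or.inr ?_
      rw [totalDegree, Finset.sup_lt_iff (by simpa using hn)]
      exact fun s hs => h hs
  · rintro (rfl | h) s hs
    · simp at hs
    · exact (le_totalDegree hs).trans_lt h

theorem mem_polysDegreeLT_succ {n : ℕ} {p : MvPolynomial (Fin 2) ℝ} :
    p ∈ polysDegreeLT (n + 1) ↔ p.totalDegree ≤ n := by
  rw [mem_polysDegreeLT, Nat.lt_succ_iff, or_iff_right_iff_imp]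
  rintro rfl
  simp

theorem mul_mem_polysDegreeLT_iff {n : ℕ} {l p : MvPolynomial (Fin 2) ℝ}
    (hl : l.totalDegree = 1) : l * p ∈ polysDegreeLT n ↔ p ∈ polysDegreeLT (n - 1) := by
  have hl0 : l ≠ 0 := by
    rintro rfl
    simp at hl
  rcases eq_or_ne p 0 with rfl | hp
  · simp
  · simp only [mem_polysDegreeLT, mul_eq_zero, hl0, hp, false_or,
      totalDegree_mul_of_isDomain hl0 hp, hl]
    omega

/-- Exponents of degree less than `n`, listed by their degree and first coordinate. -/
noncomputable def degreeLTEquiv (n : ℕ) :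
    {s : Fin 2 →₀ ℕ | s.degree < n} ≃ Σ i : Fin n, Fin (i + 1) where
  toFun s := ⟨⟨s.1.degree, s.2⟩, ⟨s.1 0, by
    simp only [Finsupp.degree_eq_sum, Fin.sum_univ_two]; omega⟩⟩
  invFun t := ⟨Finsupp.equivFunOnFinite.symm ![t.2, t.1 - t.2], by
    have := t.1.2
    have := t.2.2
    simp only [Set.mem_ofPred_eq, Finsupp.degree_eq_sum, Fin.sum_univ_two,
      Finsupp.coe_equivFunOnFinite_symm, Matrix.cons_val_zero, Matrix.cons_val_one]
    omega⟩
  left_inv s := by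
    ext i
    fin_cases i <;> simp [Finsupp.degree_eq_sum, Fin.sum_univ_two]
  right_inv := by
    rintro ⟨⟨i, hi⟩, ⟨j, hj⟩⟩
    have h : j + (i - j) = i := by simp at hj; omega
    have hs : (Finsupp.equivFunOnFinite.symm ![j, i - j] : Fin 2 →₀ ℕ).degree = i := by
      simp [Finsupp.degree_eq_sum, Fin.sum_univ_two, h]
    refine Sigma.ext (Fin.ext hs) ?_
    exact (Fin.heq_ext_iff (congrArg (· + 1) hs)).mpr rfl

instance (n : ℕ) : Finite {s : Fin 2 →₀ ℕ | s.degree < n} :=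
  Finite.of_equiv _ (degreeLTEquiv n).symm

instance (n : ℕ) : Module.Finite ℝ (polysDegreeLT n) :=
  Module.Finite.of_basis (basisRestrictSupport ℝ _)

theorem two_mul_finrank_polysDegreeLT (n : ℕ) :
    2 * Module.finrank ℝ (polysDegreeLT n) = n * (n + 1) := by
  have h : Module.finrank ℝ (polysDegreeLT n) = ∑ i ∈ Finset.range n, (i + 1) := by
    rw [polysDegreeLT, Module.finrank_eq_nat_card_basis (basisRestrictSupport ℝ _),
      Nat.card_congr (degreeLTEquiv n), Nat.card_eq_fintype_card, Fintype.card_sigma]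
    simp [Finset.sum_range]
  rw [h, ← add_zero (∑ i ∈ Finset.range n, (i + 1)), ← Finset.sum_range_succ' (fun i => i) n,
    mul_comm 2, Finset.sum_range_id_mul_two, Nat.add_sub_cancel, mul_comm]

theorem totalDegree_X_one_sub :
    (X 1 - 3 * X 0 : MvPolynomial (Fin 2) ℝ).totalDegree = 1 := by
  apply le_antisymm
  · refine (totalDegree_sub _ _).trans (max_le (totalDegree_X _).le ?_)
    refine (totalDegree_mul _ _).trans ?_
    rw [totalDegree_X, show (3 : MvPolynomial (Fin 2) ℝ) = C 3 from (map_ofNat C 3).symm, totalDegree_C]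
  · by_contra h
    have h0 := totalDegree_eq_zero_iff_eq_C.mp (Nat.lt_one_iff.mp (not_le.mp h))
    have h1 := congrArg (eval ![0, 0]) h0
    have h2 := congrArg (eval ![0, 1]) h0
    simp at h1 h2
    linarith

/-- The free parametrization of the splines on the 4-cycle. -/
noncomputable def splineParam :
    (MvPolynomial (Fin 2) ℝ × MvPolynomial (Fin 2) ℝ × MvPolynomial (Fin 2) ℝ ×
      MvPolynomial (Fin 2) ℝ) →ₗ[ℝ] (Fin 4 → MvPolynomial (Fin 2) ℝ) where
  toFun p :=
    ![p.1,
      p.1 + X 1 * (p.2.1 + p.2.2.1 + X 0 * p.2.2.2),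
      p.1 + X 0 * (3 * p.2.1 + X 1 * p.2.2.2) + X 1 * p.2.2.1,
      p.1 + X 0 * (3 * p.2.1 + X 1 * p.2.2.2)]
  map_add' p q := by
    ext1 i
    fin_cases i <;> simp <;> ring
  map_smul' c p := by
    ext1 i
    fin_cases i <;> simp [smul_eq_C_mul] <;> ring

theorem splineParam_apply (f b c t : MvPolynomial (Fin 2) ℝ) :
    splineParam (f, b, c, t) =
      ![f, f + X 1 * (b + c + X 0 * t), f + X 0 * (3 * b + X 1 * t) + X 1 * c,
        f + X 0 * (3 * b + X 1 * t)] := rfl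

theorem splineParam_injective : Function.Injective splineParam := by
  rw [← LinearMap.ker_eq_bot, LinearMap.ker_eq_bot']
  rintro ⟨f, b, c, t⟩ h
  have h0 : f = 0 := congrFun h 0
  have h1 : f + X 1 * (b + c + X 0 * t) = 0 := congrFun h 1
  have h2 : f + X 0 * (3 * b + X 1 * t) + X 1 * c = 0 := congrFun h 2
  have h3 : f + X 0 * (3 * b + X 1 * t) = 0 := congrFun h 3
  have hx : (X 0 : MvPolynomial (Fin 2) ℝ) ≠ 0 := X_ne_zero 0
  have hy : (X 1 : MvPolynomial (Fin 2) ℝ) ≠ 0 := X_ne_zero 1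
  have hl : (X 1 - 3 * X 0 : MvPolynomial (Fin 2) ℝ) ≠ 0 := by
    intro h
    simpa [h] using totalDegree_X_one_sub
  have hc : c = 0 := by
    refine (mul_eq_zero.mp (?_ : X 1 * c = 0)).resolve_left hy
    linear_combination h2 - h3
  have hb : b = 0 := by
    refine (mul_eq_zero.mp (?_ : (X 1 - 3 * X 0) * b = 0)).resolve_left hl
    linear_combination h1 - h2
  subst h0 hc hb
  have ht : t = 0 := by simpa [hx, hy] using h1
  simp [ht]

theorem map_splineParam (d : ℕ) :
    ((polysDegreeLT (d + 1)).prod ((polysDegreeLT d).prod ((polysDegreeLT d).prod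
      (polysDegreeLT (d - 1))))).map splineParam =
    splineSubmodule (X 1) (X 1 - 3 * X 0) (X 1) (X 0) 0 d := by
  have hx : (X 0 : MvPolynomial (Fin 2) ℝ).totalDegree = 1 := totalDegree_X 0
  have hy : (X 1 : MvPolynomial (Fin 2) ℝ).totalDegree = 1 := totalDegree_X 1
  have hy0 : (X 1 : MvPolynomial (Fin 2) ℝ) ≠ 0 := X_ne_zero 1
  have three_mul_mem {n : ℕ} {p : MvPolynomial (Fin 2) ℝ} (hp : p ∈ polysDegreeLT n) :
      3 * p ∈ polysDegreeLT n := by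
    have h : p + p + p = 3 * p := by ring
    exact h ▸ add_mem (add_mem hp hp) hp
  ext g
  constructor
  · rintro ⟨⟨f, b, c, t⟩, ⟨hf, hb, hc, ht⟩, rfl⟩
    simp only [SetLike.mem_coe] at hf hb hc ht
    have hxe : X 0 * (3 * b + X 1 * t) ∈ polysDegreeLT (d + 1) :=
      (mul_mem_polysDegreeLT_iff hx).mpr
        (add_mem (three_mul_mem hb) ((mul_mem_polysDegreeLT_iff hy).mpr ht))
    have hya : X 1 * (b + c + X 0 * t) ∈ polysDegreeLT (d + 1) :=
      (mul_mem_polysDegreeLT_iff hy).mpr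
        (add_mem (add_mem hb hc) ((mul_mem_polysDegreeLT_iff hx).mpr ht))
    have hyc : X 1 * c ∈ polysDegreeLT (d + 1) := (mul_mem_polysDegreeLT_iff hy).mpr hc
    refine ⟨⟨-(b + c + X 0 * t), ?_⟩, ⟨b, ?_⟩, ⟨c, ?_⟩, ⟨3 * b + X 1 * t, ?_⟩, fun i => ?_⟩
    · simp [splineParam_apply]; ring
    · simp [splineParam_apply]; ring
    · simp [splineParam_apply]
    · simp [splineParam_apply]
    · have h1 := add_mem hf hya
      have h3 := add_mem hf hxe
      have h2 := add_mem h3 hyc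
      rw [mem_polysDegreeLT_succ] at hf h1 h2 h3
      fin_cases i
      exacts [hf, h1, h2, h3]
  · rintro ⟨⟨a, ha⟩, ⟨b, hb⟩, ⟨c, hc⟩, ⟨e, he⟩, hdeg⟩
    simp only [zero_add, pow_one] at ha hb hc he
    have hg (i : Fin 4) : g i ∈ polysDegreeLT (d + 1) := mem_polysDegreeLT_succ.mpr (hdeg i)
    have hbm : b ∈ polysDegreeLT d :=
      (mul_mem_polysDegreeLT_iff (n := d + 1) totalDegree_X_one_sub).mp
        (by rw [← hb]; exact sub_mem (hg 1) (hg 2))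
    have hcm : c ∈ polysDegreeLT d :=
      (mul_mem_polysDegreeLT_iff (n := d + 1) hy).mp (by rw [← hc]; exact sub_mem (hg 2) (hg 3))
    have hem : e ∈ polysDegreeLT d :=
      (mul_mem_polysDegreeLT_iff (n := d + 1) hx).mp (by rw [← he]; exact sub_mem (hg 3) (hg 0))
    have hrel : X 0 * (e - 3 * b) = X 1 * -(a + b + c) := by
      linear_combination -ha - hb - hc - he
    obtain ⟨t, ht⟩ : X 1 ∣ e - 3 * b := by
      refine (X_dvd_mul_iff.mp ⟨_, hrel⟩).resolve_left fun h => ?_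
      simp [X_dvd_X] at h
    have hta : X 0 * t = -(a + b + c) := by
      apply mul_left_cancel₀ hy0
      linear_combination hrel - X 0 * ht
    have htm : t ∈ polysDegreeLT (d - 1) :=
      (mul_mem_polysDegreeLT_iff hy).mp
        (by rw [← ht]; exact sub_mem hem (three_mul_mem hbm))
    refine ⟨(g 0, b, c, t), ⟨hg 0, hbm, hcm, htm⟩, ?_⟩
    ext1 i
    fin_cases i
    · rfl
    · change g 0 + X 1 * (b + c + X 0 * t) = g 1
      linear_combination X 1 * hta + ha
    · change g 0 + X 0 * (3 * b + X 1 * t) + X 1 * c = g 2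
      linear_combination -X 0 * ht - he - hc
    · change g 0 + X 0 * (3 * b + X 1 * t) = g 3
      linear_combination -X 0 * ht - he

/-- For the 4-cycle with edge labels `y, y − 3x, y, x` and every `d ≥ 0`, the real
dimension of `S⁰_d(G)` equals `2d² + 2d + 1`: the dimension of the space of
continuous splines only depends on the combinatorics of the triangulation. -/
theorem dim_S0d_three_slopes (d : ℕ) :
    Module.finrank ℝ
      (splineSubmodule (X 1) (X 1 - 3 * X 0) (X 1) (X 0) 0 d) =
      2 * d ^ 2 + 2 * d + 1 := by
  let ι := (polysDegreeLT (d + 1)).subtype.prodMap ((polysDegreeLT d).subtype.prodMap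
    ((polysDegreeLT d).subtype.prodMap (polysDegreeLT (d - 1)).subtype))
  have hι : Function.Injective ι :=
    (Submodule.subtype_injective _).prodMap ((Submodule.subtype_injective _).prodMap
      ((Submodule.subtype_injective _).prodMap (Submodule.subtype_injective _)))
  have hrange : (splineParam ∘ₗ ι).range =
      splineSubmodule (X 1) (X 1 - 3 * X 0) (X 1) (X 0) 0 d := by
    simp only [← map_splineParam, LinearMap.range_comp, ι, LinearMap.range_prodMap,
      Submodule.range_subtype]
  have hinj : Function.Injective (splineParam ∘ₗ ι) := splineParam_injective.comp hι
  rw [← hrange, LinearMap.finrank_range_of_inj hinj]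
  simp only [Module.finrank_prod]
  have h0 := two_mul_finrank_polysDegreeLT (d + 1)
  have h1 := two_mul_finrank_polysDegreeLT d
  have h2 := two_mul_finrank_polysDegreeLT (d - 1)
  cases d with
  | zero => simp only [zero_add] at h0 h1 ⊢; omega
  | succ d => simp only [Nat.add_sub_cancel] at h2 ⊢; nlinarith
end
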